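/- arXiv:1601.01786 — 2 statements merged into one kernel-verified Lean document; each statement's English description precedes it below -/
import Mathlib

section
/- Let N be the gadget multi-layer network over protocols A={a,b} constructed from a finite symmetric directed graph H=(V',E') with n=|V'| and distinguished nodes S', D'. Every feasible path from S to D in N that traverses each arc at most once begins by traversing the tail S=C_0, C_1, ..., C_n, C_{n+1}, S_1 straight through (applying (a→aa) at each C_i for i=1,...,n and (a→ab) at C_{n+1}), arriving at S_1 in configuration (current protocol b, stack containing n+1 occurrences of a), and must subsequently visit the node U_4 for every U' ∈ V' exactly once (since the n occurrences of a encapsulated in the tail can be decapsulated only at nodes of type U_4, and the arc constraint allows each U_4 to be visited at most once). -/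
/-- An adaptation function: conversion `(a→b)` (passive when `a = b`),
encapsulation `(a→ab)`, or decapsulation `dec(a→ab)`. -/
inductive AdaptFn (A : Type*) where
  | conv : A → A → AdaptFn A
  | encap : A → A → AdaptFn A
  | decap : A → A → AdaptFn A
  deriving DecidableEq

/-- How an adaptation function transforms a configuration
(current protocol, stack of encapsulated protocols):
`(a→b)` maps `(a,σ)` to `(b,σ)`; `(a→ab)` maps `(a,σ)` to `(b,aσ)`;
`dec(a→ab)` maps `(b,aσ)` to `(a,σ)`; otherwise it is inapplicable. -/
inductive AdaptStep {A : Type*} : AdaptFn A → A × List A → A × List A → Prop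
  | conv (x y : A) (σ : List A) : AdaptStep (.conv x y) (x, σ) (y, σ)
  | encap (x y : A) (σ : List A) : AdaptStep (.encap x y) (x, σ) (y, x :: σ)
  | decap (x y : A) (σ : List A) : AdaptStep (.decap x y) (y, x :: σ) (x, σ)

/-- A multi-layer network: a directed graph `Edge` on nodes `V` together with,
for each node, the set `F` of adaptation functions available there. -/
structure MLNetwork (V A : Type*) where
  Edge : V → V → Prop
  F : V → Set (AdaptFn A)

/-- `Run N c steps c'`: starting in configuration `c`, the adaptation functions of
`steps` are successively applicable (each being available at the node where it is
applied) and lead to configuration `c'`. -/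
inductive Run {V A : Type*} (N : MLNetwork V A) :
    A × List A → List (V × AdaptFn A) → A × List A → Prop
  | nil (c : A × List A) : Run N c [] c
  | cons {U : V} {f : AdaptFn A} {c c' c'' : A × List A} {rest : List (V × AdaptFn A)} :
      f ∈ N.F U → AdaptStep f c c' → Run N c' rest c'' → Run N c ((U, f) :: rest) c''

/-- Node sequence of the path `S U₁ f₁ U₂ f₂ ... Uₙ fₙ D`. -/
def nodeSeq {V A : Type*} (S D : V) (steps : List (V × AdaptFn A)) : List V :=
  S :: steps.map Prod.fst ++ [D]

/-- `S U₁ f₁ ... Uₙ fₙ D` (with `steps = [(U₁,f₁),...,(Uₙ,fₙ)]`) is a feasible path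
from `S` to `D` with source protocol `s`: consecutive nodes are linked by arcs,
each `fᵢ ∈ F(Uᵢ)`, the functions are successively applicable starting from
configuration `(s, empty stack)`, and the final stack at `D` is empty. -/
def IsFeasiblePath {V A : Type*} (N : MLNetwork V A) (S D : V) (s : A)
    (steps : List (V × AdaptFn A)) : Prop :=
  (nodeSeq S D steps).Chain' N.Edge ∧ ∃ x : A, Run N (s, []) steps (x, [])

/-- A walk given by its vertex list traverses each arc at most once. -/
def ArcsOnce {V : Type*} (l : List V) : Prop := (l.zip l.tail).Nodup

/-- The two protocols `a` and `b` of the gadget network. -/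
inductive Proto where
  | a | b
  deriving DecidableEq

/-- Nodes of the gadget network: `gadget U' i` is `U_{i+1}` for `i : Fin 4`
(so `gadget U' 0 = U₁`, ..., `gadget U' 3 = U₄`), `tail i` is `C_i`
(with `C_0 = S` the source; indices `> n+1` are isolated unused nodes),
`X` is the auxiliary node and `dst` is the destination `D`. -/
inductive GNode (V' : Type*) where
  | gadget : V' → Fin 4 → GNode V'
  | tail : ℕ → GNode V'
  | X : GNode V'
  | dst : GNode V'
  deriving DecidableEq

/-- Arcs of the gadget network built from the digraph `(V', E')` with `n = |V'|`:
`(U_i,U_{i+1})` and `(U_{i+1},U_i)` for `i=1,2,3`; `(U₁,V₁)` for each arc `(U',V') ∈ E'`;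
`(C_i,C_{i+1})` and `(C_{i+1},C_i)` for `i = 0,...,n`; `(C_{n+1},S₁)` and `(S₁,C_{n+1})`;
`(D₁,X),(X,D₁),(X,D),(D,X)`. -/
def GEdge {V' : Type*} (E' : V' → V' → Prop) (n : ℕ) (S' D' : V') :
    GNode V' → GNode V' → Prop
  | .gadget U i, .gadget W j =>
      (U = W ∧ (i.val + 1 = j.val ∨ j.val + 1 = i.val)) ∨ (i = 0 ∧ j = 0 ∧ E' U W)
  | .tail i, .tail j => (i + 1 = j ∨ j + 1 = i) ∧ i ≤ n + 1 ∧ j ≤ n + 1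
  | .tail i, .gadget U j => i = n + 1 ∧ U = S' ∧ j = 0
  | .gadget U j, .tail i => i = n + 1 ∧ U = S' ∧ j = 0
  | .gadget U j, .X => U = D' ∧ j = 0
  | .X, .gadget U j => U = D' ∧ j = 0
  | .X, .dst => True
  | .dst, .X => True
  | _, _ => False

/-- Adaptation functions of the gadget network: `F(C_i) = {(a→aa)}` for `1 ≤ i ≤ n`,
`F(C_{n+1}) = {(a→ab)}`, `F(U₁) = {(b→bb),(a→ab)}`, `F(U₂) = {dec(b→bb),(a→a)}`,
`F(U₃) = {dec(a→ab),(a→a)}`, `F(U₄) = {dec(a→aa)}`, `F(X) = {dec(a→ab)}`,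
and no function elsewhere. -/
def GF {V' : Type*} (n : ℕ) : GNode V' → Set (AdaptFn Proto)
  | .gadget _ i =>
      if i.val = 0 then {.encap .b .b, .encap .a .b}
      else if i.val = 1 then {.decap .b .b, .conv .a .a}
      else if i.val = 2 then {.decap .a .b, .conv .a .a}
      else {.decap .a .a}
  | .tail i =>
      if 1 ≤ i ∧ i ≤ n then {.encap .a .a}
      else if i = n + 1 then {.encap .a .b} else ∅
  | .X => {.decap .a .b}
  | .dst => ∅

/-- The gadget multi-layer network built from `(V', E')` with `n = |V'|`,
source `S = tail 0` and destination `D = dst`. -/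
def gadgetNet {V' : Type*} (E' : V' → V' → Prop) (n : ℕ) (S' D' : V') :
    MLNetwork (GNode V') Proto :=
  ⟨GEdge E' n S' D', GF n⟩

/-- The node/function sequence
`U₁ (b→bb) U₂ dec(b→bb) U₃ dec(a→ab) U₄ dec(a→aa) U₃ (a→a) U₂ (a→a) U₁ (a→ab)`. -/
def gadgetSeq {V' : Type*} (U : V') : List (GNode V' × AdaptFn Proto) :=
  [(.gadget U 0, .encap .b .b), (.gadget U 1, .decap .b .b), (.gadget U 2, .decap .a .b),
   (.gadget U 3, .decap .a .a), (.gadget U 2, .conv .a .a), (.gadget U 1, .conv .a .a),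
   (.gadget U 0, .encap .a .b)]

/-- The steps traversing the tail straight through:
`C₁ (a→aa) C₂ (a→aa) ... Cₙ (a→aa) C_{n+1} (a→ab)`. -/
def tailSteps {V' : Type*} (n : ℕ) : List (GNode V' × AdaptFn Proto) :=
  ((List.range n).map fun i => (GNode.tail (i + 1), AdaptFn.encap Proto.a Proto.a)) ++
    [(GNode.tail (n + 1), AdaptFn.encap Proto.a Proto.b)]

/-- The full step list of the path from `S` to `D` built from a node order `l`:
the tail, then one `gadgetSeq` per node of `l`, then `X dec(a→ab)`. -/
def hamSteps {V' : Type*} (n : ℕ) (l : List V') : List (GNode V' × AdaptFn Proto) :=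
  tailSteps n ++ l.flatMap gadgetSeq ++ [(.X, .decap .a .b)]

/-- `l` is the vertex sequence of a directed Hamiltonian path from `S'` to `D'`
in the digraph `(V', E')`. -/
def IsDirHamPath {V' : Type*} (E' : V' → V' → Prop) (S' D' : V') (l : List V') : Prop :=
  l.head? = some S' ∧ l.getLast? = some D' ∧ l.Chain' E' ∧ l.Nodup ∧ ∀ v : V', v ∈ l

theorem Run.mem_F {V A : Type*} {N : MLNetwork V A} {c c' : A × List A}
    {steps : List (V × AdaptFn A)} (h : Run N c steps c') :
    ∀ p ∈ steps, p.2 ∈ N.F p.1 := by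
  induction h with
  | nil => simp
  | cons hf _ _ ih => simpa using ⟨hf, fun a b => ih (a, b)⟩

theorem ArcsOnce.index_eq {V : Type*} {l : List V} (h : ArcsOnce l) {i j : ℕ} {x y : V}
    (hi : l[i]? = some x) (hi' : l[i + 1]? = some y)
    (hj : l[j]? = some x) (hj' : l[j + 1]? = some y) : i = j := by
  have key : ∀ k, l[k]? = some x → l[k + 1]? = some y →
      (l.zip l.tail)[k]? = some (x, y) := by
    intro k hk hk'
    simp [List.getElem?_zip_eq_some, hk, hk']
  have hi2 := key i hi hi'
  exact (List.getElem?_inj (List.getElem?_eq_some_iff.1 hi2).1 h).1 (hi2.trans (key j hj hj').symm)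

theorem isChain_rel_of_getElem? {V : Type*} {R : V → V → Prop} {l : List V}
    (h : l.IsChain R) {i : ℕ} {x y : V}
    (hi : l[i]? = some x) (hi' : l[i + 1]? = some y) : R x y := by
  obtain ⟨h1, rfl⟩ := List.getElem?_eq_some_iff.1 hi
  obtain ⟨h2, rfl⟩ := List.getElem?_eq_some_iff.1 hi'
  exact List.isChain_iff_getElem.1 h i h2

theorem nodeSeq_exists_next {V A : Type*} {S D : V} {steps : List (V × AdaptFn A)} {i : ℕ} {x : V}
    (hi : (nodeSeq S D steps)[i]? = some x) (hx : x ≠ D) :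
    ∃ y, (nodeSeq S D steps)[i + 1]? = some y := by
  obtain ⟨h1, h2⟩ := List.getElem?_eq_some_iff.1 hi
  have hlen : i + 1 < (nodeSeq S D steps).length := by
    by_contra hlt
    have hl : (nodeSeq S D steps).length = steps.length + 2 := by simp [nodeSeq]
    obtain rfl : i = steps.length + 1 := by omega
    exact hx (by rw [← h2]; simp [nodeSeq])
  exact ⟨_, List.getElem?_eq_getElem hlen⟩

section Gadget

variable {V' : Type*} {E' : V' → V' → Prop} {n : ℕ} {S' D' : V'}

theorem GEdge.of_tail {k : ℕ} {y : GNode V'} (h : GEdge E' n S' D' (.tail k) y) :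
    (y = .tail (k + 1) ∧ k ≤ n) ∨ (∃ j, j + 1 = k ∧ y = .tail j) ∨
      (k = n + 1 ∧ y = .gadget S' 0) := by
  cases y with
  | gadget U j => simp only [GEdge] at h; grind
  | tail j => simp only [GEdge] at h; grind
  | X => simp [GEdge] at h
  | dst => simp [GEdge] at h

theorem GEdge.to_gadget_three {x : GNode V'} {U : V'} (h : GEdge E' n S' D' x (.gadget U 3)) :
    x = .gadget U 2 := by
  cases x with
  | gadget W i =>
    simp only [GEdge] at h
    fin_cases i <;> simp_all
  | tail j => simp [GEdge] at h
  | X => simp [GEdge] at h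
  | dst => simp [GEdge] at h

theorem run_gadgetNet_count [Fintype V'] [DecidableEq V'] {c c' : Proto × List Proto}
    {steps : List (GNode V' × AdaptFn Proto)} (h : Run (gadgetNet E' n S' D') c steps c') :
    (c.1 :: c.2).count .a + (steps.map Prod.snd).count (.encap .a .a) ≤
      (c'.1 :: c'.2).count .a + ∑ U : V', (steps.map Prod.fst).count (.gadget U 3) := by
  induction h with
  | nil => simp
  | @cons W f c c' c'' rest hf hs _ ih =>
    simp only [List.map_cons, List.count_cons, Finset.sum_add_distrib] at ih ⊢
    suffices hstep : (c.1 :: c.2).count .a + (if f == .encap .a .a then 1 else 0) ≤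
        (c'.1 :: c'.2).count .a + ∑ U : V', (if W == .gadget U 3 then 1 else 0) by
      simp only [List.count_cons] at hstep
      omega
    simp only [gadgetNet] at hf
    cases W with
    | gadget U i =>
      have hU : ∑ W : V', (if GNode.gadget U 3 == GNode.gadget W 3 then 1 else 0) = 1 := by simp
      fin_cases i <;> simp [GF] at hf <;> grind [AdaptStep]
    | tail j => simp only [GF] at hf; grind [AdaptStep]
    | X => simp only [GF] at hf; grind [AdaptStep]
    | dst => simp [GF] at hf

theorem tail_straight {steps : List (GNode V' × AdaptFn Proto)}
    (hchain : (nodeSeq (.tail 0) .dst steps).IsChain (GEdge E' n S' D'))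
    (honce : ArcsOnce (nodeSeq (GNode.tail 0) GNode.dst steps)) :
    ∀ k ≤ n + 1, (∀ j ≤ k, (nodeSeq (.tail 0) .dst steps)[j]? = some (.tail j)) ∧
      ∀ j < k, ∀ i, (nodeSeq (.tail 0) .dst steps)[i]? = some (.tail j) → i = j := by
  intro k
  induction k with
  | zero => simp [nodeSeq]
  | succ k ih =>
    intro hk
    obtain ⟨hpos, huniq⟩ := ih (by omega)
    have next : ∀ i, k ≤ i → (nodeSeq (.tail 0) .dst steps)[i]? = some (.tail k) →
        (nodeSeq (.tail 0) .dst steps)[i + 1]? = some (.tail (k + 1)) := by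
      intro i hki hi
      obtain ⟨y, hy⟩ := nodeSeq_exists_next hi (by simp)
      rcases (isChain_rel_of_getElem? hchain hi hy).of_tail with ⟨rfl, _⟩ | ⟨j, hj, rfl⟩ | ⟨h, _⟩
      · exact hy
      · have := huniq j (by omega) _ hy
        omega
      · omega
    have hk1 := next k le_rfl (hpos k le_rfl)
    refine ⟨fun j hj => ?_, fun j hj i hi => ?_⟩
    · rcases Nat.le_succ_iff.1 hj with h | rfl
      · exact hpos j h
      · exact hk1
    · rcases Nat.lt_succ_iff_lt_or_eq.1 hj with h | rfl
      · exact huniq j h i hi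
      · by_cases hij : j ≤ i
        · exact honce.index_eq hi (next i hij hi) (hpos j le_rfl) hk1
        · have := hpos i (by omega)
          simp_all

theorem run_encap_replicate (N : MLNetwork (GNode V') Proto) (x : Proto) (l : List ℕ)
    (g : ℕ → GNode V') (hl : ∀ i ∈ l, .encap x x ∈ N.F (g i)) (σ : List Proto)
    {rest : List (GNode V' × AdaptFn Proto)} {c : Proto × List Proto}
    (hrest : Run N (x, List.replicate l.length x ++ σ) rest c) :
    Run N (x, σ) (l.map (fun i => (g i, .encap x x)) ++ rest) c := by
  induction l generalizing σ with
  | nil => simpa using hrest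
  | cons i l ih =>
    refine .cons (hl i (by simp)) (.encap x x σ) (ih (fun j hj => hl j (by simp [hj])) _ ?_)
    rwa [List.length_cons, List.replicate_succ', List.append_assoc] at hrest

theorem run_tailSteps : Run (gadgetNet E' n S' D') (.a, []) (tailSteps n)
    (.b, List.replicate (n + 1) Proto.a) := by
  refine run_encap_replicate _ _ _ (fun i => .tail (i + 1)) ?_ _ ?_
  · intro i hi
    have : i < n := by simpa using hi
    have : i + 1 ≤ n := this
    simp [gadgetNet, GF, this]
  · refine .cons (by simp [gadgetNet, GF]) (.encap _ _ _) ?_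
    simpa [List.replicate_succ] using Run.nil _

theorem tailSteps_length : (tailSteps n : List (GNode V' × AdaptFn Proto)).length = n + 1 := by
  simp [tailSteps]

theorem steps_start_with_tailSteps {steps : List (GNode V' × AdaptFn Proto)}
    (hF : ∀ p ∈ steps, p.2 ∈ GF n p.1)
    (hpos : ∀ i ≤ n, (steps.map Prod.fst)[i]? = some (.tail (i + 1))) :
    tailSteps n <+: steps := by
  rw [List.prefix_iff_getElem?]
  intro i hi
  have hin : i ≤ n := by
    rw [tailSteps_length] at hi
    omega
  have h := hpos i hin
  rw [List.getElem?_map, Option.map_eq_some_iff] at h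
  obtain ⟨⟨W, f⟩, hp, rfl⟩ := h
  have hf := hF _ (List.mem_of_getElem? hp)
  rw [hp]
  rcases hin.lt_or_eq with h | rfl
  · simp only [GF, if_pos (show 1 ≤ i + 1 ∧ i + 1 ≤ n by omega)] at hf
    simp_all [tailSteps]
  · simp_all [tailSteps, GF]

theorem count_gadget_three_le_one [DecidableEq V'] {steps : List (GNode V' × AdaptFn Proto)}
    (hchain : (nodeSeq (.tail 0) .dst steps).IsChain (GEdge E' n S' D'))
    (honce : ArcsOnce (nodeSeq (GNode.tail 0) GNode.dst steps)) (U : V') :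
    (steps.map Prod.fst).count (.gadget U 3) ≤ 1 := by
  by_contra! hcount
  obtain ⟨i, j, hij, hi, hj⟩ : ∃ i j, i < j ∧ (steps.map Prod.fst)[i]? = some (GNode.gadget U 3) ∧
      (steps.map Prod.fst)[j]? = some (GNode.gadget U 3) := by
    have hdup := List.duplicate_iff_two_le_count.2 hcount
    obtain ⟨⟨i, hi⟩, ⟨j, hj⟩, hij, h1, h2⟩ := List.duplicate_iff_exists_distinct_get.1 hdup
    exact ⟨i, j, hij, List.getElem?_eq_some_iff.2 ⟨hi, h1.symm⟩,
      List.getElem?_eq_some_iff.2 ⟨hj, h2.symm⟩⟩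
  have prev : ∀ k, (steps.map Prod.fst)[k]? = some (.gadget U 3) →
      (nodeSeq (.tail 0) .dst steps)[k]? = some (.gadget U 2) ∧
      (nodeSeq (.tail 0) .dst steps)[k + 1]? = some (.gadget U 3) := by
    intro k hk
    have hk1 : (nodeSeq (.tail 0) .dst steps)[k + 1]? = some (.gadget U 3) := by
      have hlt := (List.getElem?_eq_some_iff.1 hk).1
      simpa [nodeSeq, List.getElem?_append_left hlt] using hk
    have hlt : k < (nodeSeq (.tail 0) .dst steps).length := by
      have := (List.getElem?_eq_some_iff.1 hk1).1
      omega
    have hk0 := List.getElem?_eq_getElem hlt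
    exact ⟨hk0.trans (congrArg some (isChain_rel_of_getElem? hchain hk0 hk1).to_gadget_three), hk1⟩
  have := honce.index_eq (prev i hi).1 (prev i hi).2 (prev j hj).1 (prev j hj).2
  omega

end Gadget

/-- In the gadget network built from a finite symmetric digraph
`(V', E')` with `n = |V'|`, every feasible path from `S` to `D` (source protocol `a`)
traversing each arc at most once begins by traversing the tail straight through
(`tailSteps n` is a prefix of its steps), the next node reached is `S₁`, the
configuration reached after the tail is `(b, aⁿ⁺¹)`, and the path visits the node
`U₄` exactly once for every `U' ∈ V'`. -/
theorem feasible_starts_with_tail_and_visits_U4 {V' : Type*} [Fintype V'] [DecidableEq V']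
    (E' : V' → V' → Prop) (hsym : ∀ u v : V', E' u v ↔ E' v u) (S' D' : V')
    (steps : List (GNode V' × AdaptFn Proto))
    (hfeas : IsFeasiblePath (gadgetNet E' (Fintype.card V') S' D') (.tail 0) .dst .a steps)
    (honce : ArcsOnce (nodeSeq (GNode.tail 0) GNode.dst steps)) :
    tailSteps (Fintype.card V') <+: steps ∧
    (steps.map Prod.fst)[Fintype.card V' + 1]? = some (GNode.gadget S' 0) ∧
    Run (gadgetNet E' (Fintype.card V') S' D') (.a, []) (tailSteps (Fintype.card V'))
      (.b, List.replicate (Fintype.card V' + 1) Proto.a) ∧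
    ∀ U : V', (steps.map Prod.fst).count (GNode.gadget U 3) = 1 := by
  obtain ⟨hchain, x, hrun⟩ := hfeas
  set n := Fintype.card V'
  have hF := hrun.mem_F
  obtain ⟨hpos, huniq⟩ := tail_straight hchain honce (n + 1) le_rfl
  have map_of_seq : ∀ i y, (nodeSeq (.tail 0) .dst steps)[i + 1]? = some y → y ≠ .dst →
      (steps.map Prod.fst)[i]? = some y := by
    intro i y hy hne
    simp only [nodeSeq, List.cons_append, List.getElem?_cons_succ, List.getElem?_append] at hy
    split_ifs at hy with h
    · exact hy
    · rw [List.getElem?_singleton] at hy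
      split_ifs at hy
      exact absurd (Option.some.inj hy).symm hne
  have hstart : tailSteps n <+: steps :=
    steps_start_with_tailSteps hF fun i hi => map_of_seq i _ (hpos (i + 1) (by omega)) (by simp)
  refine ⟨hstart, ?_, run_tailSteps, ?_⟩
  · obtain ⟨y, hy⟩ := nodeSeq_exists_next (hpos (n + 1) le_rfl) (by simp)
    rcases (isChain_rel_of_getElem? hchain (hpos (n + 1) le_rfl) hy).of_tail with
      ⟨_, h⟩ | ⟨j, hj, rfl⟩ | ⟨_, rfl⟩
    · omega
    · have := huniq j (by omega) _ hy
      omega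
    · exact map_of_seq _ _ hy (by simp)
  · have hle := count_gadget_three_le_one hchain honce
    have hcount := run_gadgetNet_count hrun
    have hencap : n ≤ (steps.map Prod.snd).count (.encap .a .a) := by
      refine le_trans ?_ ((hstart.map Prod.snd).sublist.count_le _)
      simp [tailSteps, Function.comp_def]
    have hx : [x].count Proto.a ≤ 1 := List.count_le_length
    have hsum : ∑ U : V', (steps.map Prod.fst).count (GNode.gadget U 3) = ∑ _U : V', 1 := by
      refine le_antisymm (Finset.sum_le_sum fun U _ => hle U) ?_
      simp only [List.count_singleton_self] at hcount
      simp only [Finset.sum_const, Finset.card_univ, smul_eq_mul, mul_one]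
      omega
    exact fun U => (Finset.sum_eq_sum_iff_of_le fun U _ => hle U).1 hsum U (Finset.mem_univ U)
end

section
/- For every multi-layer network N=(G,A,F), every pair of nodes (S,D), and every source protocol s ∈ A, the set of traces of feasible paths from S to D in N — where the trace of a feasible path records, in order, one symbol per step: the symbol x ∈ A if the step applies a conversion from the current protocol into x, the marked symbol x̄ if the step applies an encapsulation of the current protocol x, and the marked symbol x̲ if the step applies a decapsulation performed while the current protocol is x — is a context-free language over the alphabet A ∪ {x̄ : x∈A} ∪ {x̲ : x∈A}; i.e., there exists a context-free grammar generating exactly this set of words. -/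
/-- The trace alphabet `A ∪ {x̄ : x ∈ A} ∪ {x̲ : x ∈ A}`: `plain x` is `x`
(conversion into `x`), `enc x` is `x̄` (encapsulation of the current protocol `x`),
and `dec x` is `x̲` (decapsulation performed while the current protocol is `x`). -/
inductive TraceSym (A : Type*) where
  | plain : A → TraceSym A
  | enc : A → TraceSym A
  | dec : A → TraceSym A
  deriving DecidableEq

/-- The trace of a path: one symbol per step — `y` for a conversion `(x→y)` into `y`,
`x̄` for an encapsulation `(x→xy)` of the current protocol `x`, and `y̲` for a
decapsulation `dec(x→xy)` performed while the current protocol is `y`. -/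
def traceOf {V A : Type*} (steps : List (V × AdaptFn A)) : List (TraceSym A) :=
  steps.map fun p =>
    match p.2 with
    | .conv _ y => .plain y
    | .encap x _ => .enc x
    | .decap _ y => .dec y

namespace ContextFreeGrammar

variable {T : Type*}

/-- The language denoted by a sentential form when each nonterminal `n` denotes `φ n`. -/
def formLanguage {N : Type*} (φ : N → Language T) : List (Symbol T N) → Language T
  | [] => 1
  | .terminal t :: u => {[t]} * formLanguage φ u
  | .nonterminal n :: u => φ n * formLanguage φ u

theorem formLanguage_append {N : Type*} (φ : N → Language T) (u v : List (Symbol T N)) :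
    formLanguage φ (u ++ v) = formLanguage φ u * formLanguage φ v := by
  induction u with
  | nil => simp [formLanguage]
  | cons x u ih => cases x <;> simp [formLanguage, ih, mul_assoc]

theorem mem_formLanguage_map_terminal {N : Type*} (φ : N → Language T) (w : List T) :
    w ∈ formLanguage φ (w.map Symbol.terminal) := by
  induction w with
  | nil => exact Language.nil_mem_one
  | cons t w ih => exact ⟨[t], rfl, w, ih, rfl⟩

theorem Derives.formLanguage_le {g : ContextFreeGrammar T} {φ : g.NT → Language T}
    (hφ : ∀ r ∈ g.rules, formLanguage φ r.output ≤ φ r.input) {u v : List (Symbol T g.NT)}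
    (h : g.Derives u v) : formLanguage φ v ≤ formLanguage φ u := by
  induction h with
  | refl => exact le_rfl
  | tail _ hp ih =>
    refine le_trans ?_ ih
    obtain ⟨r, hr, hrw⟩ := hp
    obtain ⟨p, q, rfl, rfl⟩ := hrw.exists_parts
    simp only [formLanguage_append]
    gcongr
    simpa [formLanguage] using hφ r hr

/-- Any solution of the inequations given by the rules contains the generated language. -/
theorem language_le_of_rules {g : ContextFreeGrammar T} {φ : g.NT → Language T}
    (hφ : ∀ r ∈ g.rules, formLanguage φ r.output ≤ φ r.input) :
    g.language ≤ φ g.initial := by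
  intro w hw
  have := Derives.formLanguage_le hφ hw (mem_formLanguage_map_terminal φ w)
  simpa [formLanguage] using this

theorem derives_of_mem_rules {g : ContextFreeGrammar T} {n : g.NT} {u : List (Symbol T g.NT)}
    (h : ⟨n, u⟩ ∈ g.rules) : g.Derives [.nonterminal n] u :=
  Produces.single ⟨_, h, ContextFreeRule.Rewrites.input_output⟩

end ContextFreeGrammar

/-- Words labelling the stack-neutral runs between two states of a push-down system, where
`loc p t q` is a move reading `t` which leaves the stack alone, and `nest p t p' r t' r'` pairs a
push from `p` to `p'` reading `t` with a matching pop from `r` to `r'` reading `t'`. -/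
inductive NestedRun {Q T : Type*} (loc : Q → T → Q → Prop)
    (nest : Q → T → Q → Q → T → Q → Prop) : Q → Q → List T → Prop
  | nil (p : Q) : NestedRun loc nest p p []
  | local_cons {p t p' q w} : loc p t p' → NestedRun loc nest p' q w →
      NestedRun loc nest p q (t :: w)
  | nest_cons {p t p' r t' r' q w w'} : nest p t p' r t' r' → NestedRun loc nest p' r w →
      NestedRun loc nest r' q w' → NestedRun loc nest p q (t :: (w ++ t' :: w'))

namespace NestedRun

variable {Q T : Type*} (loc : Q → T → Q → Prop) (nest : Q → T → Q → Q → T → Q → Prop)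

/-- The rules of the grammar generating the nested runs from `p₀` to a state in `fin`; the
nonterminal `some (e p, e q)` generates the nested runs from `p` to `q`. -/
inductive GrammarRule {n : ℕ} (e : Q ≃ Fin n) (p₀ : Q) (fin : Q → Prop) :
    ContextFreeRule T (Option (Fin n × Fin n)) → Prop
  | start {q} : fin q → GrammarRule e p₀ fin ⟨none, [.nonterminal (some (e p₀, e q))]⟩
  | nil (p) : GrammarRule e p₀ fin ⟨some (e p, e p), []⟩
  | local_cons {p t p'} (q) : loc p t p' → GrammarRule e p₀ fin
      ⟨some (e p, e q), [.terminal t, .nonterminal (some (e p', e q))]⟩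
  | nest_cons {p t p' r t' r'} (q) : nest p t p' r t' r' → GrammarRule e p₀ fin
      ⟨some (e p, e q), [.terminal t, .nonterminal (some (e p', e r)), .terminal t',
        .nonterminal (some (e r', e q))]⟩

theorem finite_grammarRule [Finite T] {n : ℕ} (e : Q ≃ Fin n) (p₀ : Q) (fin : Q → Prop) :
    {r | GrammarRule loc nest e p₀ fin r}.Finite := by
  have : Finite Q := Finite.of_equiv _ e.symm
  let f₁ : Q → ContextFreeRule T (Option (Fin n × Fin n)) :=
    fun q ↦ ⟨none, [.nonterminal (some (e p₀, e q))]⟩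
  let f₂ : Q → ContextFreeRule T (Option (Fin n × Fin n)) := fun p ↦ ⟨some (e p, e p), []⟩
  let f₃ : Q × T × Q × Q → ContextFreeRule T (Option (Fin n × Fin n)) := fun ⟨p, t, p', q⟩ ↦
    ⟨some (e p, e q), [.terminal t, .nonterminal (some (e p', e q))]⟩
  let f₄ : Q × T × Q × Q × T × Q × Q → ContextFreeRule T (Option (Fin n × Fin n)) :=
    fun ⟨p, t, p', r, t', r', q⟩ ↦
      ⟨some (e p, e q), [.terminal t, .nonterminal (some (e p', e r)), .terminal t',
        .nonterminal (some (e r', e q))]⟩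
  refine ((((Set.finite_range f₁).union (Set.finite_range f₂)).union
    (Set.finite_range f₃)).union (Set.finite_range f₄)).subset ?_
  rintro _ (@⟨q, -⟩ | ⟨p⟩ | @⟨p, t, p', q, -⟩ | @⟨p, t, p₁, r, t₁, r₁, q, -⟩)
  · exact .inl (.inl (.inl ⟨q, rfl⟩))
  · exact .inl (.inl (.inr ⟨p, rfl⟩))
  · exact .inl (.inr ⟨(p, t, p', q), rfl⟩)
  · exact .inr ⟨(p, t, p₁, r, t₁, r₁, q), rfl⟩

/-- The grammar generating the nested runs from `p₀` to a state in `fin`. -/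
noncomputable def grammar [Finite T] {n : ℕ} (e : Q ≃ Fin n) (p₀ : Q) (fin : Q → Prop) :
    ContextFreeGrammar T where
  NT := Option (Fin n × Fin n)
  initial := none
  rules := (finite_grammarRule loc nest e p₀ fin).toFinset

variable {loc nest}

theorem mem_grammar_rules [Finite T] {n : ℕ} {e : Q ≃ Fin n} {p₀ : Q} {fin : Q → Prop}
    {r : ContextFreeRule T (Option (Fin n × Fin n))} :
    r ∈ (grammar loc nest e p₀ fin).rules ↔ GrammarRule loc nest e p₀ fin r :=
  Set.Finite.mem_toFinset _

theorem derives [Finite T] {n : ℕ} (e : Q ≃ Fin n) (p₀ : Q) (fin : Q → Prop) {p q : Q}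
    {w : List T} (h : NestedRun loc nest p q w) :
    (grammar loc nest e p₀ fin).Derives [.nonterminal (some (e p, e q))]
      (w.map Symbol.terminal) := by
  induction h with
  | nil p => exact ContextFreeGrammar.derives_of_mem_rules (mem_grammar_rules.2 (.nil p))
  | @local_cons p t p' q w ht _ ih =>
    exact (ContextFreeGrammar.derives_of_mem_rules
      (mem_grammar_rules.2 (.local_cons q ht))).trans (ih.append_left [.terminal t])
  | @nest_cons p t p' r t' r' q w w' ht _ _ ih ih' =>
    rw [List.map_cons, List.map_append, List.map_cons]
    exact (ContextFreeGrammar.derives_of_mem_rules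
      (mem_grammar_rules.2 (.nest_cons q ht))).trans <|
      ((ih.append_right [.terminal t', .nonterminal (some (e r', e q))]).append_left
        [.terminal t]).trans <|
      ((ih'.append_left [.terminal t']).append_left (w.map .terminal)).append_left [.terminal t]

theorem language_grammar_le [Finite T] {n : ℕ} (e : Q ≃ Fin n) (p₀ : Q) (fin : Q → Prop) :
    (grammar loc nest e p₀ fin).language ≤ {w | ∃ q, fin q ∧ NestedRun loc nest p₀ q w} := by
  let φ : Option (Fin n × Fin n) → Language T
    | none => {w | ∃ q, fin q ∧ NestedRun loc nest p₀ q w}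
    | some (i, j) => {w | NestedRun loc nest (e.symm i) (e.symm j) w}
  refine ContextFreeGrammar.language_le_of_rules (g := grammar loc nest e p₀ fin) (φ := φ) ?_
  intro r hr
  have hφ (p q : Q) (w : List T) : w ∈ φ (some (e p, e q)) ↔ NestedRun loc nest p q w := by
    change NestedRun loc nest (e.symm (e p)) (e.symm (e q)) w ↔ _
    simp
  cases mem_grammar_rules.1 hr with
  | @start q hq =>
    simp only [ContextFreeGrammar.formLanguage, mul_one]
    exact fun w hw ↦ ⟨q, hq, (hφ _ _ _).1 hw⟩
  | nil p =>
    rintro _ rfl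
    exact (hφ _ _ _).2 (.nil p)
  | local_cons q ht =>
    simp only [ContextFreeGrammar.formLanguage, mul_one]
    rintro _ ⟨_, rfl, w, hw, rfl⟩
    exact (hφ _ _ _).2 (.local_cons ht ((hφ _ _ _).1 hw))
  | nest_cons q ht =>
    simp only [ContextFreeGrammar.formLanguage, mul_one]
    rintro _ ⟨_, rfl, _, ⟨w, hw, _, ⟨_, rfl, w', hw', rfl⟩, rfl⟩, rfl⟩
    exact (hφ _ _ _).2 (.nest_cons ht ((hφ _ _ _).1 hw) ((hφ _ _ _).1 hw'))

theorem isContextFree [Finite Q] [Finite T] (p₀ : Q) (fin : Q → Prop) :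
    Language.IsContextFree
      ({w | ∃ q, fin q ∧ NestedRun loc nest p₀ q w} : Language T) := by
  obtain ⟨n, ⟨e⟩⟩ := Finite.exists_equiv_fin Q
  refine ⟨grammar loc nest e p₀ fin, le_antisymm (language_grammar_le e p₀ fin) ?_⟩
  rintro w ⟨q, hq, hw⟩
  exact (ContextFreeGrammar.derives_of_mem_rules
    (mem_grammar_rules.2 (.start hq))).trans (hw.derives e p₀ fin)

end NestedRun

instance {A : Type*} [Finite A] : Finite (TraceSym A) := by
  refine Finite.of_surjective (α := A ⊕ A ⊕ A)
    (Sum.elim TraceSym.plain (Sum.elim TraceSym.enc TraceSym.dec)) ?_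
  rintro (a | a | a)
  · exact ⟨.inl a, rfl⟩
  · exact ⟨.inr (.inl a), rfl⟩
  · exact ⟨.inr (.inr a), rfl⟩

theorem Run.append {V A : Type*} {N : MLNetwork V A} {c c' c'' : A × List A}
    {steps steps' : List (V × AdaptFn A)} (h : Run N c steps c') (h' : Run N c' steps' c'') :
    Run N c (steps ++ steps') c'' := by
  induction h with
  | nil => exact h'
  | cons hf hstep _ ih => exact .cons hf hstep (ih h')

namespace MLNetwork

variable {V A : Type*} (N : MLNetwork V A)

/-- A move to a neighbouring node where a conversion is applied. -/
inductive ConvMove : V × A → TraceSym A → V × A → Prop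
  | mk {U U₁ : V} {a b : A} : N.Edge U U₁ → .conv a b ∈ N.F U₁ →
      ConvMove (U, a) (.plain b) (U₁, b)

/-- A move applying an encapsulation, together with a matching decapsulation. -/
inductive NestMove : V × A → TraceSym A → V × A → V × A → TraceSym A → V × A → Prop
  | mk {U U₁ X X₁ : V} {a b c : A} : N.Edge U U₁ → .encap a b ∈ N.F U₁ →
      N.Edge X X₁ → .decap a c ∈ N.F X₁ →
      NestMove (U, a) (.enc a) (U₁, b) (X, c) (.dec c) (X₁, a)

/-- The traces of stack-neutral paths between pairs of a node and a protocol. -/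
abbrev Neutral : V × A → V × A → List (TraceSym A) → Prop :=
  NestedRun N.ConvMove N.NestMove

/-- The traces of the paths to `D` which pop a given stack entirely, split at the moments where
the entries of the initial stack are popped. -/
def Emptying (D : V) : V × A → List A → List (TraceSym A) → Prop
  | p, [], w => ∃ q : V × A, N.Edge q.1 D ∧ N.Neutral p q w
  | p, a :: σ, w => ∃ (X Y : V) (b : A) (w₁ w₂ : List (TraceSym A)), w = w₁ ++ .dec b :: w₂ ∧
      N.Neutral p (X, b) w₁ ∧ N.Edge X Y ∧ .decap a b ∈ N.F Y ∧ Emptying D (Y, a) σ w₂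

variable {N}

theorem Emptying.append_left {D : V} {p p' : V × A} {σ : List A} {u w : List (TraceSym A)}
    (hp : ∀ q v, N.Neutral p' q v → N.Neutral p q (u ++ v)) (h : N.Emptying D p' σ w) :
    N.Emptying D p σ (u ++ w) := by
  cases σ with
  | nil =>
    obtain ⟨q, hq, h⟩ := h
    exact ⟨q, hq, hp _ _ h⟩
  | cons a σ =>
    obtain ⟨X, Y, b, w₁, w₂, rfl, h₁, h⟩ := h
    exact ⟨X, Y, b, u ++ w₁, w₂, by simp, hp _ _ h₁, h⟩

theorem emptying_of_run {D : V} {c c' : A × List A} {steps : List (V × AdaptFn A)}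
    (h : Run N c steps c') (hc' : c'.2 = []) {U : V}
    (hU : (nodeSeq U D steps).IsChain N.Edge) :
    N.Emptying D (U, c.1) c.2 (traceOf steps) := by
  induction h generalizing U with
  | nil c =>
    rw [hc']
    exact ⟨(U, c.1), by simpa [nodeSeq] using hU, .nil _⟩
  | @cons U' f c c' c'' rest hf hstep _ ih =>
    obtain ⟨hE, hchain⟩ : N.Edge U U' ∧ (nodeSeq U' D rest).IsChain N.Edge := by
      simpa [nodeSeq] using hU
    have ih := ih hc' hchain
    cases hstep with
    | conv x y σ =>
      exact ih.append_left (u := [.plain y]) fun _ _ hv ↦ .local_cons (.mk hE hf) hv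
    | encap x y σ =>
      obtain ⟨X, Y, b, w₁, w₂, hw, h₁, hXY, hY, h₂⟩ := ih
      have := h₂.append_left (p := (U, x)) (u := .enc x :: (w₁ ++ [.dec b]))
        fun _ _ hv ↦ by simpa using NestedRun.nest_cons (.mk hE hf hXY hY) h₁ hv
      simpa [traceOf, ← hw] using this
    | decap x y σ => exact ⟨U, U', y, [], _, rfl, .nil _, hE, hf, ih⟩

theorem Neutral.exists_run {p q : V × A} {w : List (TraceSym A)} (h : N.Neutral p q w) :
    ∃ steps : List (V × AdaptFn A), traceOf steps = w ∧
      (∀ σ, Run N (p.2, σ) steps (q.2, σ)) ∧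
      ∀ l, (q.1 :: l).IsChain N.Edge → (p.1 :: (steps.map Prod.fst ++ l)).IsChain N.Edge := by
  induction h with
  | nil p => exact ⟨[], rfl, fun _ ↦ .nil _, fun _ hl ↦ hl⟩
  | @local_cons p t p' q w ht _ ih =>
    obtain ⟨steps, rfl, hrun, hchain⟩ := ih
    obtain ⟨hE, hf⟩ := ht
    exact ⟨(_, .conv _ _) :: steps, rfl, fun σ ↦ .cons hf (.conv _ _ σ) (hrun σ),
      fun l hl ↦ .cons_cons hE (hchain l hl)⟩
  | @nest_cons p t p' r t' r' q w w' ht _ _ ih ih' =>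
    obtain ⟨steps, rfl, hrun, hchain⟩ := ih
    obtain ⟨steps', rfl, hrun', hchain'⟩ := ih'
    obtain ⟨hE, hf, hE', hf'⟩ := ht
    refine ⟨(_, .encap _ _) :: (steps ++ (_, .decap _ _) :: steps'), by simp [traceOf],
      fun σ ↦ .cons hf (.encap _ _ σ)
        ((hrun _).append (.cons hf' (.decap _ _ σ) (hrun' σ))), fun l hl ↦ ?_⟩
    simpa using List.IsChain.cons_cons hE (hchain _ (.cons_cons hE' (hchain' l hl)))

end MLNetwork

/-- For every finite multi-layer network `N`, nodes `S, D` and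
source protocol `s`, the set of traces of feasible paths from `S` to `D` in `N`
is a context-free language over the alphabet `A ∪ {x̄} ∪ {x̲}`. -/
theorem traces_of_feasible_paths_isContextFree {V A : Type*} [Fintype V] [Fintype A]
    (N : MLNetwork V A) (S D : V) (s : A) :
    Language.IsContextFree
      ({ w | ∃ steps : List (V × AdaptFn A),
        IsFeasiblePath N S D s steps ∧ traceOf steps = w } : Language (TraceSym A)) := by
  obtain ⟨g, hg⟩ := NestedRun.isContextFree (loc := N.ConvMove) (nest := N.NestMove) (S, s)
    (fun q ↦ N.Edge q.1 D)
  refine ⟨g, hg.trans (Set.ext fun w ↦ ⟨?_, ?_⟩)⟩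
  · rintro ⟨q, hq, hw⟩
    obtain ⟨steps, rfl, hrun, hchain⟩ := MLNetwork.Neutral.exists_run hw
    exact ⟨steps, ⟨hchain [D] (by simpa using hq), q.2, hrun []⟩, rfl⟩
  · rintro ⟨steps, ⟨hchain, x, hrun⟩, rfl⟩
    exact MLNetwork.emptying_of_run hrun rfl hchain
end
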